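/- arXiv:quant-ph/0010034 — 2 statements merged into one kernel-verified Lean document; each statement's English description precedes it below -/
import Mathlib

section
/- If N is a positive integer, m is coprime to N, P is the multiplicative order of m mod N, P is even, and m^(P/2) + 1 is not divisible by N, then gcd(m^(P/2) - 1, N) is a non-trivial factor of N, i.e., 1 < gcd(m^(P/2) - 1, N) < N. -/
theorem stmt_1 (m N P : ℕ) (hm : 0 < m) (hN : 1 < N) (hco : Nat.Coprime m N)
    (hP1 : m ^ P ≡ 1 [MOD N]) (hP0 : 0 < P)
    (hmin : ∀ k : ℕ, 0 < k → m ^ k ≡ 1 [MOD N] → P ≤ k)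
    (hPeven : Even P) (hnd : ¬ N ∣ m ^ (P / 2) + 1) :
    1 < Nat.gcd (m ^ (P / 2) - 1) N ∧ Nat.gcd (m ^ (P / 2) - 1) N < N := by
  have hone : 1 ≤ m ^ (P / 2) := Nat.one_le_pow _ _ hm
  have hsq : m ^ P = m ^ (P / 2) * m ^ (P / 2) := by
    rw [← pow_add]
    congr 1
    obtain ⟨r, rfl⟩ := hPeven
    omega
  have hdvd : N ∣ (m ^ (P / 2) - 1) * (m ^ (P / 2) + 1) := by
    have h := (Nat.modEq_iff_dvd' (Nat.one_le_pow P m hm)).mp hP1.symm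
    have hfac := Nat.mul_self_sub_mul_self_eq (m ^ (P / 2)) 1
    rw [mul_one, ← hsq, mul_comm] at hfac
    rwa [← hfac]
  constructor
  · by_contra! hle
    have hpos : 0 < Nat.gcd (m ^ (P / 2) - 1) N := Nat.gcd_pos_of_pos_right _ (by omega)
    have hcop : Nat.Coprime N (m ^ (P / 2) - 1) :=
      Nat.Coprime.symm (le_antisymm hle hpos)
    exact hnd (hcop.dvd_of_dvd_mul_left hdvd)
  · refine lt_of_le_of_ne (Nat.gcd_le_right _ (by omega)) fun heq => ?_
    have hhalf : m ^ (P / 2) ≡ 1 [MOD N] :=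
      ((Nat.modEq_iff_dvd' hone).mpr (Nat.gcd_eq_right_iff_dvd.mp heq)).symm
    have h2 : 0 < P / 2 := by
      obtain ⟨r, rfl⟩ := hPeven
      omega
    have := hmin _ h2 hhalf
    omega
end

section
/- liminf over N → ∞ of φ(N)·(ln ln N)/N equals e^{-γ}, where φ is Euler's totient function and γ is the Euler–Mascheroni constant. -/
open Filter Topology MeasureTheory Finset

/-- The weight `-log (1 - 1/p)` carried by a prime `p`, extended by zero to all naturals. -/
noncomputable def mertensWeight (n : ℕ) : ℝ :=
  if n.Prime then -Real.log (1 - 1 / n) else 0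

theorem mertensWeight_of_not_prime {n : ℕ} (hn : ¬ n.Prime) : mertensWeight n = 0 := if_neg hn

theorem le_neg_log_one_sub {x : ℝ} (hx : x < 1) : x ≤ -Real.log (1 - x) := by
  linarith [Real.log_le_sub_one_of_pos (sub_pos.2 hx)]

theorem neg_log_one_sub_le {x : ℝ} (hx : x < 1) : -Real.log (1 - x) ≤ x / (1 - x) := by
  have h := sub_pos.2 hx
  have h1 := Real.one_sub_inv_le_log_of_pos h
  have h2 : x / (1 - x) = (1 - x)⁻¹ - 1 := by field_simp; ring
  linarith

theorem one_div_le_mertensWeight {p : ℕ} (hp : p.Prime) : 1 / (p : ℝ) ≤ mertensWeight p := by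
  have : (1 : ℝ) < p := by exact_mod_cast hp.one_lt
  rw [mertensWeight, if_pos hp]
  exact le_neg_log_one_sub ((div_lt_one (by linarith)).2 this)

theorem mertensWeight_le_one_div {p : ℕ} (hp : p.Prime) :
    mertensWeight p ≤ 1 / ((p : ℝ) - 1) := by
  have h1 : (1 : ℝ) < p := by exact_mod_cast hp.one_lt
  rw [mertensWeight, if_pos hp]
  refine (neg_log_one_sub_le ((div_lt_one (by linarith)).2 h1)).trans_eq ?_
  have : (p : ℝ) - 1 ≠ 0 := by linarith
  field_simp

theorem mertensWeight_nonneg (n : ℕ) : 0 ≤ mertensWeight n := by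
  by_cases hn : n.Prime
  · exact (by positivity : (0 : ℝ) ≤ 1 / n).trans (one_div_le_mertensWeight hn)
  · rw [mertensWeight_of_not_prime hn]

theorem sum_range_mertensWeight_mul (g : ℕ → ℝ) (n : ℕ) :
    ∑ k ∈ range (n + 1), mertensWeight k * g k = ∑ p ∈ n.primesLE, mertensWeight p * g p := by
  rw [Nat.primesLE_eq_filter_range, sum_filter_of_ne]
  intro k _ hk
  by_contra h
  simp [mertensWeight_of_not_prime h] at hk

theorem log_factorial_eq_sum_primesLE (n : ℕ) :
    Real.log n.factorial = ∑ p ∈ n.primesLE, (padicValNat p n.factorial : ℝ) * Real.log p := by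
  rw [Real.log_nat_eq_sum_factorization, Finsupp.sum]
  have : n.factorial.factorization.support ⊆ n.primesLE := by
    intro p hp
    rw [Nat.support_factorization, Nat.mem_primeFactors] at hp
    exact Nat.mem_primesLE.2 ⟨(hp.1.dvd_factorial).1 hp.2.1, hp.1⟩
  rw [sum_subset this]
  · refine sum_congr rfl fun p hp => ?_
    rw [Nat.factorization_def _ (Nat.mem_primesLE.1 hp).2]
  · intro p _ hp
    simp [Finsupp.notMem_support_iff.1 hp]

theorem sum_log_div_le (n : ℕ) (hn : n ≠ 0) :
    ∑ p ∈ n.primesLE, Real.log p / p ≤ Real.log n + Real.log 4 := by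
  have hn' : (0 : ℝ) < n := by positivity
  have h1 : Real.log n.factorial ≤ n * Real.log n := by
    rw [← Real.log_pow]
    exact Real.log_le_log (by positivity) (by exact_mod_cast Nat.factorial_le_pow n)
  have h2 : ∑ p ∈ n.primesLE, ((n : ℝ) / p - 1) * Real.log p ≤ Real.log n.factorial := by
    rw [log_factorial_eq_sum_primesLE]
    refine sum_le_sum fun p hp => ?_
    obtain ⟨hpn, hp⟩ := Nat.mem_primesLE.1 hp
    refine mul_le_mul_of_nonneg_right ?_ (Real.log_natCast_nonneg p)
    have : Fact p.Prime := ⟨hp⟩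
    have hdvd : p ^ (n / p) ∣ n.factorial := by
      refine (pow_dvd_pow p ?_).trans (pow_padicValNat_dvd (p := p))
      rw [padicValNat_factorial (Nat.lt_succ_self (Nat.log p n))]
      have := single_le_sum (f := fun i => n / p ^ i) (fun _ _ => Nat.zero_le _)
        (show 1 ∈ Ico 1 (Nat.log p n).succ by
          simpa using Nat.log_pos hp.one_lt hpn)
      simpa using this
    have hle := (padicValNat_dvd_iff_le (p := p) n.factorial_ne_zero).1 hdvd
    have h3 : (n : ℝ) / p < (n / p : ℕ) + 1 := by
      rw [← Nat.floor_div_eq_div (K := ℝ)]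
      exact Nat.lt_floor_add_one _
    have h4 : ((n / p : ℕ) : ℝ) ≤ padicValNat p n.factorial := by exact_mod_cast hle
    linarith
  have h3 : ∑ p ∈ n.primesLE, ((n : ℝ) / p - 1) * Real.log p
      = n * ∑ p ∈ n.primesLE, Real.log p / p - Chebyshev.theta n := by
    rw [Chebyshev.theta_eq_sum_primesLE_log, mul_sum, ← sum_sub_distrib]
    exact sum_congr rfl fun p _ => by ring
  have h4 := Chebyshev.theta_le_log4_mul_x hn'.le
  have : n * ∑ p ∈ n.primesLE, Real.log p / p ≤ n * (Real.log n + Real.log 4) := by linarith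
  exact le_of_mul_le_mul_left this hn'

theorem le_sum_log_div_sub_one (n : ℕ) (hn : n ≠ 0) :
    Real.log n - 1 ≤ ∑ p ∈ n.primesLE, Real.log p / ((p : ℝ) - 1) := by
  have hn' : (0 : ℝ) < n := by positivity
  have h1 := Stirling.le_log_factorial_stirling hn
  have h2 : Real.log n.factorial ≤ n * ∑ p ∈ n.primesLE, Real.log p / ((p : ℝ) - 1) := by
    rw [log_factorial_eq_sum_primesLE, mul_sum]
    refine sum_le_sum fun p hp => ?_
    obtain ⟨hpn, hp⟩ := Nat.mem_primesLE.1 hp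
    have : Fact p.Prime := ⟨hp⟩
    have hp1 : (1 : ℝ) < p := by exact_mod_cast hp.one_lt
    have h3 : (p - 1) * padicValNat p n.factorial ≤ n := by
      rw [sub_one_mul_padicValNat_factorial]; exact Nat.sub_le _ _
    have h4 : ((p : ℝ) - 1) * padicValNat p n.factorial ≤ n := by
      have : (((p - 1) * padicValNat p n.factorial : ℕ) : ℝ) ≤ n := by exact_mod_cast h3
      rwa [Nat.cast_mul, Nat.cast_sub hp.one_le, Nat.cast_one] at this
    have h5 : (padicValNat p n.factorial : ℝ) ≤ n / ((p : ℝ) - 1) := by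
      rw [le_div_iff₀ (by linarith)]; linarith
    calc _ ≤ n / ((p : ℝ) - 1) * Real.log p :=
          mul_le_mul_of_nonneg_right h5 (Real.log_natCast_nonneg p)
      _ = _ := by ring
  have h5 : 0 ≤ Real.log n := Real.log_natCast_nonneg n
  have h6 : 0 ≤ Real.log (2 * Real.pi) := Real.log_nonneg (by linarith [Real.pi_gt_three])
  have : n * (Real.log n - 1) ≤ n * ∑ p ∈ n.primesLE, Real.log p / ((p : ℝ) - 1) := by linarith
  exact le_of_mul_le_mul_left this hn'

theorem summable_log_div_mul_sub_one :
    Summable fun n : ℕ => Real.log n / ((n : ℝ) * (n - 1)) := by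
  have h : Summable fun n : ℕ => 4 * (1 / (n : ℝ) ^ (3 / 2 : ℝ)) :=
    (Real.summable_one_div_nat_rpow.2 (by norm_num)).mul_left 4
  refine h.of_norm_bounded fun n => ?_
  rcases lt_or_ge n 2 with hn | hn
  · interval_cases n <;> norm_num
  have hn' : (2 : ℝ) ≤ n := by exact_mod_cast hn
  have h1 := Real.log_le_rpow_div (x := n) (by linarith) (show (0 : ℝ) < 1 / 2 by norm_num)
  have h0 : 0 ≤ Real.log n := Real.log_natCast_nonneg n
  rw [Real.norm_of_nonneg (div_nonneg h0 (mul_nonneg (by linarith) (by linarith)))]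
  rw [div_le_iff₀ (by nlinarith), mul_one_div, div_mul_eq_mul_div,
    le_div_iff₀ (Real.rpow_pos_of_pos (by linarith) _)]
  have h2 : (n : ℝ) ^ (1 / 2 : ℝ) * (n : ℝ) ^ (3 / 2 : ℝ) = n ^ 2 := by
    rw [← Real.rpow_add (by linarith)]; norm_num
  calc Real.log n * (n : ℝ) ^ (3 / 2 : ℝ)
      ≤ ((n : ℝ) ^ (1 / 2 : ℝ) / (1 / 2)) * (n : ℝ) ^ (3 / 2 : ℝ) := by gcongr
    _ = 2 * n ^ 2 := by rw [← h2]; ring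
    _ ≤ _ := by nlinarith

/-- A weighted form of Mertens' first theorem. -/
theorem exists_abs_sum_mertensWeight_mul_log_sub_log_le :
    ∃ K, ∀ n : ℕ, n ≠ 0 →
      |∑ k ∈ range (n + 1), mertensWeight k * Real.log k - Real.log n| ≤ K := by
  set S := ∑' n : ℕ, Real.log n / ((n : ℝ) * (n - 1)) with hS
  have hnn : ∀ n : ℕ, 0 ≤ Real.log n / ((n : ℝ) * (n - 1)) := by
    intro n
    rcases Nat.eq_zero_or_pos n with rfl | hn
    · simp
    · have : (1 : ℝ) ≤ n := by exact_mod_cast hn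
      exact div_nonneg (Real.log_natCast_nonneg n) (mul_nonneg (by linarith) (by linarith))
  refine ⟨S + 1 + Real.log 4, fun n hn => ?_⟩
  rw [sum_range_mertensWeight_mul]
  have hlo : ∑ p ∈ n.primesLE, Real.log p / p
      ≤ ∑ p ∈ n.primesLE, mertensWeight p * Real.log p := by
    refine sum_le_sum fun p hp => ?_
    rw [div_eq_mul_one_div, mul_comm]
    exact mul_le_mul_of_nonneg_right (one_div_le_mertensWeight (Nat.mem_primesLE.1 hp).2)
      (Real.log_natCast_nonneg p)
  have hhi : ∑ p ∈ n.primesLE, mertensWeight p * Real.log p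
      ≤ ∑ p ∈ n.primesLE, Real.log p / ((p : ℝ) - 1) := by
    refine sum_le_sum fun p hp => ?_
    rw [div_eq_mul_one_div, mul_comm (Real.log p)]
    exact mul_le_mul_of_nonneg_right (mertensWeight_le_one_div (Nat.mem_primesLE.1 hp).2)
      (Real.log_natCast_nonneg p)
  have hdiff : ∑ p ∈ n.primesLE, Real.log p / ((p : ℝ) - 1)
      = ∑ p ∈ n.primesLE, Real.log p / p
        + ∑ p ∈ n.primesLE, Real.log p / ((p : ℝ) * (p - 1)) := by
    rw [← sum_add_distrib]
    refine sum_congr rfl fun p hp => ?_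
    have : (1 : ℝ) < p := by exact_mod_cast (Nat.mem_primesLE.1 hp).2.one_lt
    have h1 : (p : ℝ) - 1 ≠ 0 := by linarith
    have h2 : (p : ℝ) ≠ 0 := by linarith
    field_simp; ring
  have hS' : ∑ p ∈ n.primesLE, Real.log p / ((p : ℝ) * (p - 1)) ≤ S :=
    summable_log_div_mul_sub_one.sum_le_tsum _ fun i _ => hnn i
  have hS0 : 0 ≤ S := tsum_nonneg hnn
  have h4 : 0 ≤ Real.log 4 := Real.log_nonneg (by norm_num)
  have := sum_log_div_le n hn
  have := le_sum_log_div_sub_one n hn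
  rw [abs_le]
  constructor <;> linarith

theorem summable_log_log_sub :
    Summable fun i : ℕ => (Real.log (Real.log (i + 3 : ℕ)) - Real.log (Real.log (i + 2 : ℕ)))
      - (Real.log (i + 3 : ℕ) - Real.log (i + 2 : ℕ)) / Real.log (i + 3 : ℕ) := by
  have hpos : ∀ i : ℕ, 0 < Real.log (i + 2 : ℕ) := fun i =>
    Real.log_pos (by push_cast; linarith [(Nat.cast_nonneg i : (0 : ℝ) ≤ i)])
  have hmono : ∀ i : ℕ, Real.log (i + 2 : ℕ) ≤ Real.log (i + 3 : ℕ) := fun i =>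
    Real.log_le_log (by positivity) (by push_cast; linarith)
  have hdiff : ∀ i : ℕ, Real.log (i + 3 : ℕ) - Real.log (i + 2 : ℕ) ≤ 1 := fun i => by
    rw [← Real.log_div (by positivity) (by positivity)]
    refine (Real.log_le_sub_one_of_pos (by positivity)).trans ?_
    rw [sub_le_iff_le_add, div_le_iff₀ (by positivity)]
    push_cast; linarith [(Nat.cast_nonneg i : (0 : ℝ) ≤ i)]
  refine summable_of_sum_range_le (c := 1 / Real.log (0 + 2 : ℕ)) (fun i => ?_) fun n => ?_
  · have hv := hpos i
    have hu := hpos (i + 1)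
    have h := Real.one_sub_inv_le_log_of_pos (div_pos hu hv)
    rw [Real.log_div hu.ne' hv.ne', inv_div] at h
    have : (Real.log (i + 3 : ℕ) - Real.log (i + 2 : ℕ)) / Real.log (i + 3 : ℕ)
      = 1 - Real.log (i + 2 : ℕ) / Real.log (i + 3 : ℕ) := by
        rw [sub_div, div_self (hpos (i+1)).ne']
    rw [this]
    exact sub_nonneg.2 h
  · calc _ ≤ ∑ i ∈ range n, (1 / Real.log (i + 2 : ℕ) - 1 / Real.log ((i + 1) + 2 : ℕ)) := by
          refine sum_le_sum fun i _ => ?_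
          have hv := hpos i
          have hu : 0 < Real.log (i + 3 : ℕ) := hpos (i + 1)
          have h := Real.log_le_sub_one_of_pos (div_pos hu hv)
          rw [Real.log_div hu.ne' hv.ne'] at h
          change _ ≤ 1 / Real.log (i + 2 : ℕ) - 1 / Real.log (i + 3 : ℕ)
          have hm := hmono i
          have hd := hdiff i
          generalize Real.log (i + 3 : ℕ) = u at *
          generalize Real.log (i + 2 : ℕ) = v at *
          have e : u / v - 1 - (u - v) / u = (u - v) * (1 / v - 1 / u) := by
            field_simp
          have hvu := sub_nonneg.2 (one_div_le_one_div_of_le hv hm)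
          have := mul_le_of_le_one_left hvu hd
          linarith
      _ ≤ _ := by
          rw [sum_range_sub']
          have := hpos n
          have : 0 ≤ 1 / Real.log (n + 2 : ℕ) := by positivity
          linarith

/-- A weighted form of Mertens' second theorem. -/
theorem exists_tendsto_sum_mertensWeight_sub_log_log :
    ∃ C, Tendsto (fun n : ℕ => ∑ k ∈ range (n + 1), mertensWeight k - Real.log (Real.log n))
      atTop (𝓝 C) := by
  obtain ⟨K, hK⟩ := exists_abs_sum_mertensWeight_mul_log_sub_log_le
  have hpos : ∀ i : ℕ, 0 < Real.log (i + 2 : ℕ) := fun i =>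
    Real.log_pos (by push_cast; linarith [(Nat.cast_nonneg i : (0 : ℝ) ≤ i)])
  set f : ℕ → ℝ := fun i => (Real.log (i + 3 : ℕ))⁻¹
  set z : ℕ → ℝ := fun i => mertensWeight (i + 3) * Real.log (i + 3 : ℕ)
    - (Real.log (i + 3 : ℕ) - Real.log (i + 2 : ℕ))
  have hf : Antitone f := fun i j hij => inv_anti₀ (hpos (i + 1))
    (Real.log_le_log (by positivity) (by exact_mod_cast Nat.add_le_add_right hij 3))
  have hf0 : Tendsto f atTop (𝓝 0) :=
    ((Real.tendsto_log_atTop.comp tendsto_natCast_atTop_atTop).comp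
      (tendsto_add_atTop_nat 3)).inv_tendsto_atTop
  have hz : ∀ n, ∑ i ∈ range n, z i
      = (∑ k ∈ range (n + 2 + 1), mertensWeight k * Real.log k - Real.log (n + 2 : ℕ))
        - (∑ k ∈ range (2 + 1), mertensWeight k * Real.log k - Real.log 2) := by
    intro n
    induction n with
    | zero => simp
    | succ n ih =>
      rw [sum_range_succ, ih, show n + 1 + 2 + 1 = (n + 2 + 1) + 1 by ring,
        sum_range_succ _ (n + 2 + 1)]
      simp only [z]
      push_cast
      ring_nf
  have hzb : ∀ n, ‖∑ i ∈ range n, z i‖ ≤ K + K := fun n => by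
    rw [hz]
    refine (norm_sub_le _ _).trans (add_le_add (hK _ (by simp)) ?_)
    exact_mod_cast hK 2 (by simp)
  obtain ⟨L, hL⟩ := cauchySeq_tendsto_of_complete
    (hf.cauchySeq_series_mul_of_tendsto_zero_of_bounded hf0 hzb)
  have hE := summable_log_log_sub.hasSum.tendsto_sum_nat
  have h := (hL.sub hE).add_const
    (∑ k ∈ range (2 + 1), mertensWeight k - Real.log (Real.log 2))
  refine ⟨_, (tendsto_add_atTop_iff_nat 2).1 (h.congr fun n => ?_)⟩
  induction n with
  | zero => simp
  | succ n ih =>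
    rw [show n + 1 + 2 + 1 = (n + 2 + 1) + 1 by ring, sum_range_succ _ (n + 2 + 1),
      sum_range_succ, sum_range_succ]
    have h3 := (hpos (n + 1)).ne'
    have : f n • z n = mertensWeight (n + 3)
        - (Real.log (n + 3 : ℕ) - Real.log (n + 2 : ℕ)) / Real.log (n + 3 : ℕ) := by
      simp only [f, z, smul_eq_mul]
      rw [mul_sub, mul_comm (mertensWeight _), inv_mul_cancel_left₀ h3]
      ring
    rw [this]
    have e1 : n + 2 + 1 = n + 3 := rfl
    have e2 : n + 1 + 2 = n + 3 := rfl
    rw [e1, e2]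
    rw [e1] at ih
    linarith
/-- An Abelian theorem for the Laplace transform. -/
theorem tendsto_integral_mul_exp_neg_mul {F : ℝ → ℝ} {L B : ℝ} (hF : Measurable F)
    (hB : ∀ t, 0 ≤ t → |F t| ≤ B) (hL : Tendsto F atTop (𝓝 L)) :
    Tendsto (fun ε : ℝ => ∫ t in Set.Ioi (0 : ℝ), ε * Real.exp (-(ε * t)) * F t)
      (𝓝[>] 0) (𝓝 L) := by
  have h1 : Tendsto (fun ε : ℝ => ∫ u in Set.Ioi (0 : ℝ), Real.exp (-u) * F (ε⁻¹ * u))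
      (𝓝[>] 0) (𝓝 (∫ u in Set.Ioi (0 : ℝ), Real.exp (-u) * L)) := by
    refine tendsto_integral_filter_of_dominated_convergence (fun u => Real.exp (-u) * B) ?_ ?_ ?_ ?_
    · exact Eventually.of_forall fun ε => by
        refine Measurable.aestronglyMeasurable ?_
        fun_prop
    · filter_upwards [self_mem_nhdsWithin] with ε hε
      refine (ae_restrict_iff' measurableSet_Ioi).2 (Eventually.of_forall fun u hu => ?_)
      rw [norm_mul, Real.norm_of_nonneg (Real.exp_pos _).le]
      have := hB (ε⁻¹ * u) (mul_nonneg (inv_nonneg.2 (le_of_lt hε)) (le_of_lt hu))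
      gcongr
      exact this
    · exact (integrableOn_exp_neg_Ioi 0).mul_const B
    · refine (ae_restrict_iff' measurableSet_Ioi).2 (Eventually.of_forall fun u hu => ?_)
      exact (hL.comp (tendsto_inv_nhdsGT_zero.atTop_mul_const hu)).const_mul _
  rw [integral_mul_const, integral_exp_neg_Ioi_zero, one_mul] at h1
  refine h1.congr' ?_
  filter_upwards [self_mem_nhdsWithin] with ε hε
  have hε : 0 < ε := hε
  have := integral_comp_mul_left_Ioi (fun u => Real.exp (-u) * F (ε⁻¹ * u)) 0 hε
  rw [mul_zero] at this
  rw [smul_eq_mul, eq_inv_mul_iff_mul_eq₀ hε.ne', ← integral_const_mul] at this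
  rw [← this]
  refine integral_congr_ae (Eventually.of_forall fun t => ?_)
  simp only [inv_mul_cancel_left₀ hε.ne']
  ring

theorem integral_Ioi_mul_exp_neg_mul_indicator {ε l : ℝ} (hε : 0 < ε) (hl : 0 ≤ l) (a : ℝ) :
    Integrable (fun t => ε * Real.exp (-(ε * t)) * (if l ≤ t then a else 0))
      (volume.restrict (Set.Ioi 0)) ∧
    ∫ t in Set.Ioi (0 : ℝ), ε * Real.exp (-(ε * t)) * (if l ≤ t then a else 0)
      = a * Real.exp (-(ε * l)) := by
  have e : (fun t => ε * Real.exp (-(ε * t)) * (if l ≤ t then a else 0))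
      = Set.indicator (Set.Ici l) fun t => (ε * a) * Real.exp (-ε * t) := by
    ext t
    by_cases h : l ≤ t
    · rw [Set.indicator_of_mem (Set.mem_Ici.2 h), if_pos h, neg_mul]; ring
    · rw [Set.indicator_of_notMem (by simpa using h), if_neg h, mul_zero]
  have hint : IntegrableOn (fun t => (ε * a) * Real.exp (-ε * t)) (Set.Ioi l) :=
    (exp_neg_integrableOn_Ioi l hε).const_mul _
  have hae : (Set.Ici l ∩ Set.Ioi 0 : Set ℝ) =ᵐ[volume] Set.Ioi l := by
    have h1 : (Set.Ici l ∩ Set.Ioi 0 : Set ℝ) =ᵐ[volume] (Set.Ioi l ∩ Set.Ioi 0 : Set ℝ) :=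
      Ioi_ae_eq_Ici.symm.inter (ae_eq_refl _)
    rwa [Set.Ioi_inter_Ioi, sup_of_le_left hl] at h1
  rw [e]
  constructor
  · rw [integrable_indicator_iff measurableSet_Ici, IntegrableOn,
      Measure.restrict_restrict measurableSet_Ici, Measure.restrict_congr_set hae]
    exact hint
  · rw [integral_indicator measurableSet_Ici, Measure.restrict_restrict measurableSet_Ici,
      Measure.restrict_congr_set hae, integral_const_mul, integral_exp_mul_Ioi (by linarith)]
    field_simp

/-- The Laplace transform of the summatory function of a nonnegative general Dirichlet series. -/
theorem integral_mul_exp_neg_mul_tsum {a l : ℕ → ℝ} (ha : ∀ n, 0 ≤ a n) (hl : ∀ n, 0 ≤ l n)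
    {ε : ℝ} (hε : 0 < ε) (hs : Summable fun n => a n * Real.exp (-(ε * l n))) :
    ∫ t in Set.Ioi (0 : ℝ), ε * Real.exp (-(ε * t)) * ∑' n, (if l n ≤ t then a n else 0)
      = ∑' n, a n * Real.exp (-(ε * l n)) := by
  have h := fun n => integral_Ioi_mul_exp_neg_mul_indicator hε (hl n) (a n)
  have hnorm : ∀ n, ∀ t, ‖ε * Real.exp (-(ε * t)) * (if l n ≤ t then a n else 0)‖
      = ε * Real.exp (-(ε * t)) * (if l n ≤ t then a n else 0) := fun n t => by
    refine Real.norm_of_nonneg (mul_nonneg (by positivity) ?_)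
    split_ifs
    exacts [ha n, le_rfl]
  have := hasSum_integral_of_summable_integral_norm (fun n => (h n).1) (by
    simp only [hnorm, fun n => (h n).2]
    exact hs)
  simp only [fun n => (h n).2, tsum_mul_left] at this
  exact this.tsum_eq.symm

/-- If the summatory functions of two nonnegative general Dirichlet series differ asymptotically
by a constant, then so do the series at the origin. -/
theorem tendsto_tsum_sub_tsum {a b l m : ℕ → ℝ} (ha : ∀ n, 0 ≤ a n) (hb : ∀ n, 0 ≤ b n)
    (hl : ∀ n, 0 ≤ l n) (hm : ∀ n, 0 ≤ m n) (hl' : Tendsto l atTop atTop)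
    (hm' : Tendsto m atTop atTop) {L : ℝ}
    (ha0 : ∃ n, 0 < a n) (hb0 : ∃ n, 0 < b n)
    (hsa : ∀ ε, 0 < ε → Summable fun n => a n * Real.exp (-(ε * l n)))
    (hsb : ∀ ε, 0 < ε → Summable fun n => b n * Real.exp (-(ε * m n)))
    (hL : Tendsto (fun t : ℝ => ∑' n, (if l n ≤ t then a n else 0)
      - ∑' n, (if m n ≤ t then b n else 0)) atTop (𝓝 L)) :
    Tendsto (fun ε : ℝ => ∑' n, a n * Real.exp (-(ε * l n)) - ∑' n, b n * Real.exp (-(ε * m n)))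
      (𝓝[>] 0) (𝓝 L) := by
  have mono : ∀ {a l : ℕ → ℝ}, (∀ n, 0 ≤ a n) → Tendsto l atTop atTop →
      Monotone fun t : ℝ => ∑' n, (if l n ≤ t then a n else 0) := by
    intro a l ha hl' s t hst
    have hsum : ∀ t, Summable fun n => if l n ≤ t then a n else 0 := fun t => by
      obtain ⟨N, hN⟩ := (eventually_atTop.1 (hl'.eventually_gt_atTop t))
      refine summable_of_ne_finset_zero (s := range N) fun n hn => ?_
      rw [if_neg]
      exact not_le.2 (hN n (by simpa using hn))
    refine (hsum s).tsum_le_tsum (fun n => ?_) (hsum t)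
    by_cases h : l n ≤ s
    · rw [if_pos h, if_pos (h.trans hst)]
    · rw [if_neg h]; split_ifs; exacts [ha n, le_rfl]
  have hA := mono ha hl'
  have hB := mono hb hm'
  have integrable : ∀ {a l : ℕ → ℝ}, (∀ n, 0 ≤ a n) → (∀ n, 0 ≤ l n) → (∃ n, 0 < a n) →
      ∀ {ε : ℝ}, 0 < ε → (Summable fun n => a n * Real.exp (-(ε * l n))) →
      Integrable (fun t => ε * Real.exp (-(ε * t)) * ∑' n, (if l n ≤ t then a n else 0))
        (volume.restrict (Set.Ioi 0)) := by
    intro a l ha hl ⟨n, hn⟩ ε hε hs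
    refine Integrable.of_integral_ne_zero ?_
    rw [integral_mul_exp_neg_mul_tsum ha hl hε hs]
    exact (hs.tsum_pos (fun n => mul_nonneg (ha n) (Real.exp_pos _).le) n
      (mul_pos hn (Real.exp_pos _))).ne'
  set F := fun t : ℝ => ∑' n, (if l n ≤ t then a n else 0)
      - ∑' n, (if m n ≤ t then b n else 0) with hF
  obtain ⟨T, hT⟩ := eventually_atTop.1 (hL.abs.eventually_le_const (lt_add_one |L|))
  have hbd : ∃ M, ∀ t, 0 ≤ t → |F t| ≤ M := by
    refine ⟨max (|L| + 1) (max (∑' n, (if l n ≤ T then a n else 0))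
      (∑' n, (if m n ≤ T then b n else 0))), fun t ht => ?_⟩
    rcases le_total T t with h | h
    · exact (hT t h).trans (le_max_left _ _)
    · refine le_max_of_le_right ?_
      have h1 : (0 : ℝ) ≤ ∑' n, (if l n ≤ t then a n else 0) :=
        tsum_nonneg fun n => by split_ifs; exacts [ha n, le_rfl]
      have h2 : (0 : ℝ) ≤ ∑' n, (if m n ≤ t then b n else 0) :=
        tsum_nonneg fun n => by split_ifs; exacts [hb n, le_rfl]
      have h3 := (hA h).trans (le_max_left _ (∑' n, (if m n ≤ T then b n else 0)))
      have h4 := (hB h).trans (le_max_right (∑' n, (if l n ≤ T then a n else 0)) _)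
      simp only at h3 h4
      exact abs_sub_le_iff.2 ⟨by linarith, by linarith⟩
  obtain ⟨M, hM⟩ := hbd
  refine (tendsto_integral_mul_exp_neg_mul (hA.measurable.sub hB.measurable) hM hL).congr' ?_
  filter_upwards [self_mem_nhdsWithin] with ε hε
  rw [← integral_mul_exp_neg_mul_tsum ha hl hε (hsa ε hε),
    ← integral_mul_exp_neg_mul_tsum hb hm hε (hsb ε hε),
    ← integral_sub (integrable ha hl ha0 hε (hsa ε hε)) (integrable hb hm hb0 hε (hsb ε hε))]
  exact integral_congr_ae (Eventually.of_forall fun t => mul_sub _ _ _)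

theorem tendsto_log_natFloor_sub_log :
    Tendsto (fun x : ℝ => Real.log ⌊x⌋₊ - Real.log x) atTop (𝓝 0) := by
  have h := (tendsto_nat_floor_div_atTop (R := ℝ)).log one_ne_zero
  rw [Real.log_one] at h
  refine h.congr' ?_
  filter_upwards [eventually_ge_atTop 1] with x hx
  have : 0 < ⌊x⌋₊ := Nat.floor_pos.2 hx
  exact Real.log_div (by positivity) (by positivity)

theorem tendsto_log_log_natFloor_exp_sub_log :
    Tendsto (fun t : ℝ => Real.log (Real.log ⌊Real.exp t⌋₊) - Real.log t) atTop (𝓝 0) := by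
  have h1 := tendsto_log_natFloor_sub_log.comp Real.tendsto_exp_atTop
  have h2 : Tendsto (fun t : ℝ => Real.log ⌊Real.exp t⌋₊ / t) atTop (𝓝 1) := by
    have := (h1.mul tendsto_inv_atTop_zero).add_const 1
    rw [zero_mul, zero_add] at this
    refine this.congr' ?_
    filter_upwards [eventually_gt_atTop 0] with t ht
    simp only [Function.comp, Real.log_exp]
    field_simp
    ring
  have h3 := h2.log one_ne_zero
  rw [Real.log_one] at h3
  refine h3.congr' ?_
  filter_upwards [eventually_gt_atTop 0, h2.eventually_ne one_ne_zero] with t ht h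
  exact Real.log_div (fun h0 => h (by rw [h0, zero_div])) ht.ne'

theorem mertensWeight_le_two_div (n : ℕ) : mertensWeight n ≤ 2 / n := by
  by_cases hn : n.Prime
  · refine (mertensWeight_le_one_div hn).trans ?_
    have : (2 : ℝ) ≤ n := by exact_mod_cast hn.two_le
    rw [div_le_div_iff₀ (by linarith) (by linarith)]
    linarith
  · rw [mertensWeight_of_not_prime hn]; positivity

theorem exp_neg_mul_log_natCast {n : ℕ} (hn : n ≠ 0) (ε : ℝ) :
    Real.exp (-(ε * Real.log n)) = (n : ℝ) ^ (-ε) := by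
  rw [Real.rpow_def_of_pos (by positivity)]
  ring_nf

theorem summable_mertensWeight_mul_exp {ε : ℝ} (hε : 0 < ε) :
    Summable fun n : ℕ => mertensWeight n * Real.exp (-(ε * Real.log n)) := by
  have h : Summable fun n : ℕ => 2 * (1 / (n : ℝ) ^ (1 + ε)) :=
    (Real.summable_one_div_nat_rpow.2 (by linarith)).mul_left 2
  refine h.of_nonneg_of_le
    (fun n => mul_nonneg (mertensWeight_nonneg n) (Real.exp_pos _).le) fun n => ?_
  rcases eq_or_ne n 0 with rfl | hn
  · rw [mertensWeight_of_not_prime Nat.not_prime_zero, zero_mul]; positivity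
  · have hn' : (0 : ℝ) < n := by positivity
    rw [exp_neg_mul_log_natCast hn]
    refine (mul_le_mul_of_nonneg_right (mertensWeight_le_two_div n) (by positivity)).trans_eq ?_
    rw [Real.rpow_add hn', Real.rpow_one, Real.rpow_neg hn'.le]
    field_simp

theorem hasSum_one_div_mul_exp_neg {ε : ℝ} (hε : 0 < ε) :
    HasSum (fun n : ℕ => 1 / (n : ℝ) * Real.exp (-(ε * n))) (-Real.log (1 - Real.exp (-ε))) := by
  have h : |Real.exp (-ε)| < 1 := by
    rw [abs_of_pos (Real.exp_pos _), Real.exp_lt_one_iff]; linarith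
  refine (hasSum_nat_add_iff' 1).1 ?_
  convert! Real.hasSum_pow_div_log_of_abs_lt_one h using 1
  · ext n
    rw [← Real.exp_nat_mul]
    push_cast
    ring_nf
  · simp

theorem tendsto_log_one_sub_exp_neg_sub_log :
    Tendsto (fun ε : ℝ => Real.log (1 - Real.exp (-ε)) - Real.log ε) (𝓝[>] 0) (𝓝 0) := by
  have h : HasDerivAt (fun ε : ℝ => 1 - Real.exp (-ε)) 1 0 := by
    have := ((hasDerivAt_neg (0 : ℝ)).exp).const_sub 1
    simpa using this
  have h2 := (hasDerivAt_iff_tendsto_slope.1 h).mono_left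
    (nhdsWithin_mono 0 (fun x (hx : 0 < x) => hx.ne'))
  have h3 := h2.log one_ne_zero
  rw [Real.log_one] at h3
  refine h3.congr' ?_
  filter_upwards [self_mem_nhdsWithin] with ε hε
  have hε : 0 < ε := hε
  have : Real.exp (-ε) < 1 := by rw [Real.exp_lt_one_iff]; linarith
  rw [slope_def_field, ← Real.log_div (by linarith) hε.ne']
  simp

theorem log_re_riemannZeta_eq_tsum_primes {s : ℝ} (hs : 1 < s) :
    Real.log (riemannZeta s).re = ∑' p : Nat.Primes, -Real.log (1 - (p : ℝ) ^ (-s)) := by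
  rw [← riemannZeta_eulerProduct_exp_log (by simpa using hs)]
  have : ∀ p : Nat.Primes, -Complex.log (1 - (p : ℂ) ^ (-(s : ℂ)))
      = ((-Real.log (1 - (p : ℝ) ^ (-s)) : ℝ) : ℂ) := fun p => by
    have hp : (1 : ℝ) ≤ p := by exact_mod_cast p.2.one_le
    have : (p : ℝ) ^ (-s) ≤ 1 := Real.rpow_le_one_of_one_le_of_nonpos hp (by linarith)
    rw [Complex.ofReal_neg, Complex.ofReal_log (by linarith)]
    push_cast [Complex.ofReal_cpow (by linarith : (0 : ℝ) ≤ p)]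
    rfl
  simp only [this]
  rw [← Complex.ofReal_tsum, Complex.exp_ofReal_re, Real.log_exp]

theorem abs_neg_log_one_sub_mul_sub_le {x y : ℝ} (hx0 : 0 ≤ x) (hx : x ≤ 1 / 2)
    (hy0 : 0 ≤ y) (hy : y ≤ 1) :
    |-Real.log (1 - x * y) - -Real.log (1 - x) * y| ≤ 2 * x ^ 2 := by
  have hxy : x * y ≤ x := mul_le_of_le_one_right hx0 hy
  have hxy0 : 0 ≤ x * y := mul_nonneg hx0 hy0
  have h1 := le_neg_log_one_sub (show x * y < 1 by linarith)
  have h2 := neg_log_one_sub_le (show x * y < 1 by linarith)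
  have h3 := mul_le_mul_of_nonneg_right (le_neg_log_one_sub (show x < 1 by linarith)) hy0
  have h4 := mul_le_mul_of_nonneg_right (neg_log_one_sub_le (show x < 1 by linarith)) hy0
  have key : ∀ z : ℝ, 0 ≤ z → z ≤ 1 / 2 → z / (1 - z) ≤ z + 2 * z ^ 2 := fun z hz0 hz => by
    rw [div_le_iff₀ (by linarith)]
    nlinarith [mul_nonneg (sq_nonneg z) (by linarith : 0 ≤ 1 - 2 * z)]
  have h5 := key _ hxy0 (by linarith)
  have h6 := mul_le_mul_of_nonneg_right (key _ hx0 hx) hy0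
  have h7 : (x * y) ^ 2 ≤ x ^ 2 := pow_le_pow_left₀ hxy0 hxy 2
  have h8 : 2 * x ^ 2 * y ≤ 2 * x ^ 2 := mul_le_of_le_one_right (by positivity) hy
  rw [abs_le]
  constructor <;> nlinarith

theorem tendsto_tsum_mertensWeight_add_log :
    Tendsto (fun ε : ℝ => ∑' n : ℕ, mertensWeight n * Real.exp (-(ε * Real.log n)) + Real.log ε)
      (𝓝[>] 0) (𝓝 0) := by
  set d : ℝ → Nat.Primes → ℝ := fun ε p =>
    -Real.log (1 - 1 / (p : ℝ) * Real.exp (-(ε * Real.log p)))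
      - -Real.log (1 - 1 / (p : ℝ)) * Real.exp (-(ε * Real.log p)) with hd
  have hsum : Summable fun p : Nat.Primes => 2 * (1 / (p : ℝ)) ^ 2 := by
    have : Summable fun n : ℕ => 2 * (1 / (n : ℝ)) ^ 2 := by
      simpa using (Real.summable_one_div_nat_pow.2 one_lt_two).mul_left 2
    exact this.comp_injective Nat.Primes.coe_nat_injective
  have hbound : ∀ ε, 0 < ε → ∀ p, ‖d ε p‖ ≤ 2 * (1 / (p : ℝ)) ^ 2 := fun ε hε p => by
    have hp : (2 : ℝ) ≤ p := by exact_mod_cast p.2.two_le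
    refine abs_neg_log_one_sub_mul_sub_le (by positivity)
      (one_div_le_one_div_of_le two_pos hp) (Real.exp_pos _).le ?_
    rw [Real.exp_le_one_iff, neg_nonpos]
    exact mul_nonneg hε.le (Real.log_natCast_nonneg _)
  have hd0 : Tendsto (fun ε => ∑' p, d ε p) (𝓝[>] 0) (𝓝 (∑' _ : Nat.Primes, 0)) := by
    refine tendsto_tsum_of_dominated_convergence hsum (fun p => ?_)
      (eventually_mem_nhdsWithin.mono fun ε hε => hbound ε hε)
    have hp : (2 : ℝ) ≤ p := by exact_mod_cast p.2.two_le
    have hp' : 1 / (p : ℝ) ≤ 1 / 2 := one_div_le_one_div_of_le two_pos hp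
    have hc : ContinuousAt (fun ε => d ε p) 0 := by
      have h0 : 1 - 1 / (p : ℝ) * Real.exp (-(0 * Real.log p)) ≠ 0 := by
        rw [zero_mul, neg_zero, Real.exp_zero]; linarith
      simp only [hd]
      fun_prop (disch := exact h0)
    have := hc.tendsto.mono_left (nhdsWithin_le_nhds (s := Set.Ioi 0))
    simpa [hd] using this
  rw [tsum_zero] at hd0
  have hz : Tendsto (fun ε : ℝ => Real.log (riemannZeta (1 + ε : ℝ)).re + Real.log ε)
      (𝓝[>] 0) (𝓝 0) := by
    have h1 : Tendsto (fun ε : ℝ => 1 + ε) (𝓝[>] 0) (𝓝[>] 1) := by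
      refine tendsto_nhdsWithin_iff.2 ⟨?_, ?_⟩
      · have : Tendsto (fun ε : ℝ => 1 + ε) (𝓝 0) (𝓝 (1 + 0)) := tendsto_id.const_add 1
        rw [add_zero] at this
        exact this.mono_left nhdsWithin_le_nhds
      · filter_upwards [self_mem_nhdsWithin] with ε hε
        have : 0 < ε := hε
        simpa using this
    have := ((Asymptotics.isLittleO_one_iff ℝ).1
      log_riemannZeta_add_log_sub_isLittleO_ofReal).comp h1
    simpa [Function.comp_def] using this
  have := hz.sub hd0
  rw [sub_zero] at this
  refine this.congr' ?_
  filter_upwards [self_mem_nhdsWithin] with ε hε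
  have hε : 0 < ε := hε
  have hw : Summable fun p : Nat.Primes => mertensWeight p * Real.exp (-(ε * Real.log p)) :=
    (summable_mertensWeight_mul_exp hε).comp_injective Nat.Primes.coe_nat_injective
  have hds : Summable (d ε) := hsum.of_norm_bounded (hbound ε hε)
  have e1 : ∑' n : ℕ, mertensWeight n * Real.exp (-(ε * Real.log n))
      = ∑' p : Nat.Primes, mertensWeight p * Real.exp (-(ε * Real.log p)) := by
    refine (tsum_subtype_eq_of_support_subset (s := {p : ℕ | p.Prime}) fun n hn => ?_).symm
    by_contra h
    exact hn (by simp [mertensWeight_of_not_prime h])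
  rw [e1, log_re_riemannZeta_eq_tsum_primes (by linarith)]
  have e2 : ∀ p : Nat.Primes, -Real.log (1 - (p : ℝ) ^ (-(1 + ε)))
      = d ε p + mertensWeight p * Real.exp (-(ε * Real.log p)) := fun p => by
    have hp : (0 : ℝ) < p := by exact_mod_cast p.2.pos
    simp only [hd, mertensWeight, if_pos p.2]
    rw [sub_add_cancel, exp_neg_mul_log_natCast p.2.ne_zero, neg_add, Real.rpow_add hp,
      Real.rpow_neg_one, one_div]
  rw [tsum_congr e2, hds.tsum_add hw]
  ring

theorem tsum_ite_eq_sum_range {a l : ℕ → ℝ} {t : ℝ} {N : ℕ}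
    (h : ∀ n, a n ≠ 0 → (l n ≤ t ↔ n ≤ N)) :
    ∑' n, (if l n ≤ t then a n else 0) = ∑ n ∈ range (N + 1), a n := by
  have : ∀ n, (if l n ≤ t then a n else 0) = if n ≤ N then a n else 0 := fun n => by
    by_cases ha : a n = 0
    · simp [ha]
    · simp only [h n ha]
  rw [tsum_congr this, tsum_eq_sum (s := range (N + 1))]
  · exact sum_congr rfl fun n hn => if_pos (by simpa [Nat.lt_succ_iff] using hn)
  · intro n hn
    exact if_neg (by simpa [Nat.lt_succ_iff] using hn)

/-- Mertens' theorem, in logarithmic form. -/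
theorem tendsto_sum_mertensWeight_sub_log_log :
    Tendsto (fun n : ℕ => ∑ k ∈ range (n + 1), mertensWeight k - Real.log (Real.log n))
      atTop (𝓝 Real.eulerMascheroniConstant) := by
  obtain ⟨C, hC⟩ := exists_tendsto_sum_mertensWeight_sub_log_log
  suffices C - Real.eulerMascheroniConstant = 0 by
    rwa [← sub_eq_zero.1 this]
  have hL : Tendsto (fun t : ℝ => ∑' n : ℕ, (if Real.log n ≤ t then mertensWeight n else 0)
      - ∑' n : ℕ, (if (n : ℝ) ≤ t then 1 / (n : ℝ) else 0)) atTop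
      (𝓝 (C - Real.eulerMascheroniConstant)) := by
    have h1 := hC.comp (tendsto_nat_floor_atTop.comp Real.tendsto_exp_atTop)
    have h2 := Real.tendsto_harmonic_sub_log.comp (tendsto_nat_floor_atTop (α := ℝ))
    have h := ((h1.sub h2).add tendsto_log_log_natFloor_exp_sub_log).sub
      tendsto_log_natFloor_sub_log
    rw [add_zero, sub_zero] at h
    refine h.congr' ?_
    filter_upwards [eventually_ge_atTop 0] with t ht
    rw [tsum_ite_eq_sum_range (N := ⌊Real.exp t⌋₊), tsum_ite_eq_sum_range (N := ⌊t⌋₊)]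
    · have : ((harmonic ⌊t⌋₊ : ℚ) : ℝ) = ∑ n ∈ range (⌊t⌋₊ + 1), 1 / (n : ℝ) := by
        rw [sum_range_succ']
        simp [harmonic]
      simp only [Function.comp, this]
      ring
    · exact fun n _ => (Nat.le_floor_iff ht).symm
    · intro n hn
      have hn0 : n ≠ 0 := by
        rintro rfl
        exact hn (mertensWeight_of_not_prime Nat.not_prime_zero)
      rw [Nat.le_floor_iff (Real.exp_pos t).le, Real.log_le_iff_le_exp (by positivity)]
  have h1 := tendsto_tsum_sub_tsum (a := mertensWeight) (b := fun n => 1 / (n : ℝ))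
    (l := fun n => Real.log n) (m := fun n => n) mertensWeight_nonneg (fun n => by positivity)
    (fun n => Real.log_natCast_nonneg n) (fun n => by positivity)
    (Real.tendsto_log_atTop.comp tendsto_natCast_atTop_atTop) tendsto_natCast_atTop_atTop
    ⟨2, (by norm_num : (0 : ℝ) < 1 / (2 : ℕ)).trans_le (one_div_le_mertensWeight Nat.prime_two)⟩
    ⟨1, by norm_num⟩ (fun ε hε => summable_mertensWeight_mul_exp hε)
    (fun ε hε => (hasSum_one_div_mul_exp_neg hε).summable) hL
  have h2 := tendsto_tsum_mertensWeight_add_log.add tendsto_log_one_sub_exp_neg_sub_log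
  rw [add_zero] at h2
  refine tendsto_nhds_unique (h1.congr' ?_) h2
  filter_upwards [self_mem_nhdsWithin] with ε hε
  rw [(hasSum_one_div_mul_exp_neg hε).tsum_eq]
  ring

theorem prod_one_sub_eq_exp_neg_sum {s : Finset ℕ} (hs : ∀ p ∈ s, p.Prime) :
    ∏ p ∈ s, (1 - 1 / (p : ℝ)) = Real.exp (-∑ p ∈ s, mertensWeight p) := by
  rw [← sum_neg_distrib, Real.exp_sum]
  refine prod_congr rfl fun p hp => ?_
  have : (2 : ℝ) ≤ p := by exact_mod_cast (hs p hp).two_le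
  have : 1 / (p : ℝ) ≤ 1 / 2 := one_div_le_one_div_of_le two_pos this
  rw [mertensWeight, if_pos (hs p hp), neg_neg, Real.exp_log (by linarith)]

/-- Mertens' product theorem. -/
theorem tendsto_exp_neg_sum_mertensWeight_mul_log :
    Tendsto (fun n : ℕ => Real.exp (-∑ k ∈ range (n + 1), mertensWeight k) * Real.log n)
      atTop (𝓝 (Real.exp (-Real.eulerMascheroniConstant))) := by
  refine ((Real.continuous_exp.tendsto _).comp
    tendsto_sum_mertensWeight_sub_log_log.neg).congr' ?_
  filter_upwards [eventually_ge_atTop 2] with n hn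
  have : 0 < Real.log n := Real.log_pos (by exact_mod_cast hn)
  rw [Function.comp, neg_sub, sub_eq_neg_add, Real.exp_add, Real.exp_log this]

theorem totient_div_eq_prod {n : ℕ} (hn : n ≠ 0) :
    (n.totient : ℝ) / n = ∏ p ∈ n.primeFactors, (1 - 1 / (p : ℝ)) := by
  have h : (n.totient : ℝ) = n * ∏ p ∈ n.primeFactors, (1 - (p : ℝ)⁻¹) := by
    have := congrArg (Rat.cast (K := ℝ)) (Nat.totient_eq_mul_prod_factors n)
    push_cast at this
    exact this
  rw [h, mul_div_cancel_left₀ _ (by exact_mod_cast hn)]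
  simp only [one_div]

theorem one_sub_inv_log_le_prod {n : ℕ} {y : ℝ} (hn : n ≠ 0) (hy : y = Real.log n) (hy1 : 1 < y)
    {s : Finset ℕ} (hs : s ⊆ n.primeFactors) (hsy : ∀ p ∈ s, y ≤ p) :
    1 - (Real.log y)⁻¹ ≤ ∏ p ∈ s, (1 - 1 / (p : ℝ)) := by
  have hy0 : 0 < y := by linarith
  have hlog : 0 < Real.log y := Real.log_pos hy1
  have h1 : y ^ s.card ≤ n := by
    calc y ^ s.card ≤ ∏ p ∈ s, (p : ℝ) := by
          rw [← prod_const]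
          exact prod_le_prod (fun _ _ => hy0.le) hsy
      _ ≤ n := by
          rw [← Nat.cast_prod]
          exact Nat.cast_le.2 <| Nat.le_of_dvd (Nat.pos_of_ne_zero hn)
            ((prod_dvd_prod_of_subset _ _ _ hs).trans (Nat.prod_primeFactors_dvd n))
  have h2 : s.card * Real.log y ≤ y := by
    rw [← Real.log_pow]
    nth_rw 2 [hy]
    exact Real.log_le_log (by positivity) h1
  have h3 : (1 - 1 / y) ^ s.card ≤ ∏ p ∈ s, (1 - 1 / (p : ℝ)) := by
    rw [← prod_const]
    refine prod_le_prod (fun _ _ => ?_) fun p hp => ?_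
    · exact sub_nonneg.2 ((div_le_one hy0).2 hy1.le)
    · exact sub_le_sub_left (one_div_le_one_div_of_le hy0 (hsy p hp)) 1
  have h4 := one_add_mul_le_pow (a := -(1 / y))
    (by have := (div_le_one hy0).2 hy1.le; linarith) s.card
  rw [← sub_eq_add_neg] at h4
  have h5 : s.card * (1 / y) ≤ (Real.log y)⁻¹ := by
    rw [mul_one_div, div_le_iff₀ hy0, inv_mul_eq_div, le_div_iff₀ hlog]
    exact h2
  linarith

theorem le_totient_mul_log_log_div {n : ℕ} (hn : Real.exp 1 < Real.log n) :
    Real.exp (-∑ k ∈ range (⌊Real.log n⌋₊ + 1), mertensWeight k) * Real.log ⌊Real.log n⌋₊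
      * (1 - (Real.log (Real.log n))⁻¹) ≤ n.totient * Real.log (Real.log n) / n := by
  have hn0 : n ≠ 0 := by
    rintro rfl
    rw [Nat.cast_zero, Real.log_zero] at hn
    exact (Real.exp_pos 1).not_gt hn
  set y := Real.log n with hy
  have he := Real.add_one_le_exp 1
  have hy1 : 1 < y := by linarith
  have hlog : 1 < Real.log y := (Real.lt_log_iff_exp_lt (by linarith)).2 hn
  have hfl : 0 < ⌊y⌋₊ := Nat.floor_pos.2 hy1.le
  rw [mul_div_right_comm, totient_div_eq_prod hn0,
    ← prod_filter_mul_prod_filter_not n.primeFactors (· ≤ ⌊y⌋₊), mul_assoc, mul_assoc,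
    mul_comm (∏ p ∈ _ with ¬ _, _)]
  have h1 := one_sub_inv_log_le_prod hn0 hy hy1 (filter_subset (fun p => ¬ p ≤ ⌊y⌋₊) _)
    fun p hp => ((Nat.floor_lt (by linarith)).1 (not_le.1 (mem_filter.1 hp).2)).le
  have h2 : Real.log ⌊y⌋₊ ≤ Real.log y :=
    Real.log_le_log (by positivity) (Nat.floor_le (by linarith))
  have h3 : 0 ≤ 1 - (Real.log y)⁻¹ := sub_nonneg.2 (inv_le_one_of_one_le₀ hlog.le)
  rw [prod_one_sub_eq_exp_neg_sum (s := n.primeFactors.filter (· ≤ ⌊y⌋₊))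
    fun p hp => Nat.prime_of_mem_primeFactors (mem_filter.1 hp).1]
  gcongr
  · exact fun p _ _ => mertensWeight_nonneg p
  · intro p hp
    simpa [Nat.lt_succ_iff] using (mem_filter.1 hp).2

theorem totient_primorial_mul_log_log_div_le {n : ℕ} (hn : 2 ≤ n) :
    (primorial n).totient * Real.log (Real.log (primorial n)) / primorial n
      ≤ Real.exp (-∑ k ∈ range (n + 1), mertensWeight k) * Real.log n
        * (1 + Real.log (Real.log 4) * (Real.log n)⁻¹) := by
  have hn' : (2 : ℝ) ≤ n := by exact_mod_cast hn
  have hlog : 0 < Real.log n := Real.log_pos (by linarith)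
  have hlog4 : 0 < Real.log 4 := Real.log_pos (by norm_num)
  have h1 : Real.log (primorial n) = Chebyshev.theta n := by
    rw [Chebyshev.theta_eq_log_primorial, Nat.floor_natCast]
  have h2 : Real.log (Chebyshev.theta n) ≤ Real.log (Real.log 4) + Real.log n := by
    rw [← Real.log_mul hlog4.ne' (by linarith)]
    exact Real.log_le_log (Chebyshev.theta_pos hn') (Chebyshev.theta_le_log4_mul_x (by linarith))
  have h3 := sum_range_mertensWeight_mul 1 n
  simp only [Pi.one_apply, mul_one] at h3
  rw [mul_div_right_comm, totient_div_eq_prod (primorial_pos n).ne', primeFactors_primorial,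
    prod_one_sub_eq_exp_neg_sum fun p hp => (Nat.mem_primesLE.1 hp).2, h1, h3, mul_assoc]
  gcongr
  refine h2.trans_eq ?_
  field_simp
  ring

theorem tendsto_primorial_atTop : Tendsto primorial atTop atTop := by
  refine tendsto_atTop.2 fun M => ?_
  obtain ⟨p, hMp, hp⟩ := Nat.exists_infinite_primes M
  filter_upwards [eventually_ge_atTop p] with n hn
  have : p ∈ (primorial n).primeFactors := by
    rw [primeFactors_primorial]
    exact Nat.mem_primesLE.2 ⟨hn, hp⟩
  exact hMp.trans (Nat.le_of_mem_primeFactors this)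

theorem stmt_16 :
    Filter.liminf
      (fun N : ℕ => (Nat.totient N : ℝ) * Real.log (Real.log N) / N)
      Filter.atTop = Real.exp (-Real.eulerMascheroniConstant) := by
  set c := Real.exp (-Real.eulerMascheroniConstant)
  have hlog : Tendsto (fun n : ℕ => Real.log n) atTop atTop :=
    Real.tendsto_log_atTop.comp tendsto_natCast_atTop_atTop
  have lower : ∀ b < c, ∀ᶠ N : ℕ in atTop,
      b ≤ (Nat.totient N : ℝ) * Real.log (Real.log N) / N := by
    intro b hb
    have h := (tendsto_exp_neg_sum_mertensWeight_mul_log.comp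
      (tendsto_nat_floor_atTop.comp hlog)).mul
        ((Real.tendsto_log_atTop.comp hlog).inv_tendsto_atTop.const_sub 1)
    rw [sub_zero, mul_one] at h
    filter_upwards [h.eventually_const_le hb, hlog.eventually_gt_atTop (Real.exp 1)] with n h1 h2
    exact h1.trans (le_totient_mul_log_log_div h2)
  have upper : ∀ b, c < b → ∃ᶠ N : ℕ in atTop,
      (Nat.totient N : ℝ) * Real.log (Real.log N) / N ≤ b := by
    intro b hb
    have h := tendsto_exp_neg_sum_mertensWeight_mul_log.mul
      ((hlog.inv_tendsto_atTop.const_mul (Real.log (Real.log 4))).const_add 1)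
    rw [mul_zero, add_zero, mul_one] at h
    refine tendsto_primorial_atTop.frequently (Eventually.frequently ?_)
    filter_upwards [h.eventually_le_const hb, eventually_ge_atTop 2] with n h1 h2
    exact (totient_primorial_mul_log_log_div_le h2).trans h1
  have hbdd : IsBoundedUnder (· ≥ ·) atTop
      fun N : ℕ => (Nat.totient N : ℝ) * Real.log (Real.log N) / N :=
    ⟨c - 1, lower _ (sub_one_lt c)⟩
  have hcobdd : IsCoboundedUnder (· ≥ ·) atTop
      fun N : ℕ => (Nat.totient N : ℝ) * Real.log (Real.log N) / N :=
    IsCoboundedUnder.of_frequently_le (upper _ (lt_add_one c))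
  exact le_antisymm (le_of_forall_gt_imp_ge_of_dense fun b hb =>
      liminf_le_of_frequently_le (upper b hb) hbdd)
    (le_of_forall_lt_imp_le_of_dense fun b hb => le_liminf_of_le hcobdd (lower b hb))
end
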